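/- Let G be a finite group, g ∈ G an element of order d, H = ⟨g⟩, and A a multiset of cardinality |G| all of whose elements lie in H, written as powers of g. Then A is quotient-realizable in G if and only if A can be partitioned into [G:H] blocks A₁, ..., A_{[G:H]}, each of cardinality d, such that whenever A_j = {g^{e_{j,1}}, ..., g^{e_{j,d}}}, the exponent sum e_{j,1} + ··· + e_{j,d} ≡ 0 (mod d). -/

import Mathlib

/-- A multiset `A` of cardinality `|G|` with elements in a finite group `G` is
quotient-realizable in `G` if there are bijections `b, c : {1,…,|G|} → G` with
`A = {b(i)·c(i)⁻¹ : 1 ≤ i ≤ |G|}` as multisets. -/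
def QuotientRealizable (G : Type*) [Group G] (A : Multiset G) : Prop :=
  ∃ b c : Fin (Nat.card G) ≃ G,
    A = ↑(List.ofFn fun i => b i * (c i)⁻¹)

theorem Fintype.sum_singleton_apply {α β : Type*} [Fintype α] (F : α → β) :
    ∑ x, ({F x} : Multiset β) = Finset.univ.val.map F := by
  rw [← Multiset.sum_map_singleton (Finset.univ.val.map F), Multiset.map_map]
  rfl

/-- If `a ≠ b` lie on the same cycle of `f`, composing with the transposition `(a b)`
separates them. -/
theorem Equiv.Perm.SameCycle.not_sameCycle_mul_swap {α : Type*} [Finite α] [DecidableEq α]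
    {f : Equiv.Perm α} {a b : α} (h : f.SameCycle a b) (hab : a ≠ b) :
    ¬ (f * Equiv.swap a b).SameCycle b a := by
  classical
  have hex : ∃ k : ℕ, (f ^ k) a = b := by
    obtain ⟨k, -, hk⟩ := h.exists_pow_eq'
    exact ⟨k, hk⟩
  set k := Nat.find hex with hk
  have hkb : (f ^ k) a = b := Nat.find_spec hex
  have hmin : ∀ m < k, (f ^ m) a ≠ b := fun m hm => Nat.find_min hex hm
  have hk0 : 0 < k := by
    rcases Nat.eq_zero_or_pos k with h0 | h0
    · rw [h0] at hkb
      exact absurd hkb hab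
    · exact h0
  have hne : ∀ i, 0 < i → i ≤ k → (f ^ i) a ≠ a := by
    intro i hi hik hfix
    refine hmin (k - i) (by omega) ?_
    rw [← hkb]
    conv_rhs => rw [show k = (k - i) + i by omega, pow_add, Equiv.Perm.mul_apply, hfix]
  have hstep : ∀ n : ℕ, ∃ i, 0 < i ∧ i ≤ k ∧ ((f * Equiv.swap a b) ^ n) b = (f ^ i) a := by
    intro n
    induction n with
    | zero => exact ⟨k, hk0, le_rfl, by simp [hkb]⟩
    | succ n ih =>
      obtain ⟨i, hi, hik, hi'⟩ := ih
      rw [pow_succ', Equiv.Perm.mul_apply, hi', Equiv.Perm.mul_apply]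
      rcases hik.lt_or_eq with hlt | rfl
      · refine ⟨i + 1, by omega, hlt, ?_⟩
        rw [Equiv.swap_apply_of_ne_of_ne (hne i hi hik) (hmin i hlt), pow_succ',
          Equiv.Perm.mul_apply]
      · refine ⟨1, one_pos, hk0, ?_⟩
        rw [hkb, Equiv.swap_apply_right, pow_one]
  intro hs
  obtain ⟨n, -, hn⟩ := hs.exists_pow_eq'
  obtain ⟨i, hi, hik, hi'⟩ := hstep n
  exact hne i hi hik (hi'.symm.trans hn)

/-- Reversing the cycle of `a` in `f` does not change the multiset of unordered pairs
`{y, f y}`. -/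
theorem Equiv.Perm.exists_reverse_cycle {α M : Type*} [Fintype α]
    [AddCommMonoid M] (φ : α → α → M) (hφ : ∀ x y, φ x y = φ y x) (f : Equiv.Perm α) (a : α) :
    ∃ f' : Equiv.Perm α, f' (f a) = a ∧ (∀ y, ¬ f.SameCycle a y → f' y = f y) ∧
      ∑ y, φ y (f' y) = ∑ y, φ y (f y) := by
  classical
  let c := f.cycleOf a
  have hc : ∀ y, f.SameCycle a y → c y = f y := fun y h => h.cycleOf_apply
  have hc' : ∀ y, ¬ f.SameCycle a y → c y = y :=
    fun y h => Equiv.Perm.cycleOf_apply_of_not_sameCycle h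
  have hinv : ∀ y, f.SameCycle a y → c⁻¹ y = f⁻¹ y := by
    intro y h
    rw [Equiv.Perm.inv_eq_iff_eq, hc (f⁻¹ y) (Equiv.Perm.sameCycle_symm_apply_right.2 h)]
    simp
  have hinv' : ∀ y, ¬ f.SameCycle a y → c⁻¹ y = y := by
    intro y h
    rw [Equiv.Perm.inv_eq_iff_eq, hc' y h]
  have hin : ∀ y, f.SameCycle a y → (f * c⁻¹ * c⁻¹) y = f⁻¹ y := by
    intro y h
    have h1 : f.SameCycle a (f⁻¹ y) := Equiv.Perm.sameCycle_symm_apply_right.2 h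
    rw [Equiv.Perm.mul_apply, Equiv.Perm.mul_apply, hinv y h, hinv _ h1]
    simp
  have hout : ∀ y, ¬ f.SameCycle a y → (f * c⁻¹ * c⁻¹) y = f y := by
    intro y h
    rw [Equiv.Perm.mul_apply, Equiv.Perm.mul_apply, hinv' y h, hinv' y h]
  refine ⟨f * c⁻¹ * c⁻¹, ?_, hout, ?_⟩
  · rw [hin _ (Equiv.Perm.sameCycle_apply_right.2 (Equiv.Perm.SameCycle.refl f a))]
    simp
  · rw [← Equiv.sum_comp c]
    refine Finset.sum_congr rfl fun y _ => ?_
    by_cases h : f.SameCycle a y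
    · rw [hc y h, hin _ (Equiv.Perm.sameCycle_apply_right.2 h), hφ]
      simp
    · rw [hc' y h, hout y h]

/-- Regarding the multiset of unordered pairs `{y, f y}` as a multigraph, the edges `{a, f a}`
and `{b, f b}` may be replaced by `{f a, f b}` and `{a, b}`. -/
theorem Equiv.Perm.exists_exchange {α M : Type*} [Fintype α] [AddCancelCommMonoid M]
    (φ : α → α → M) (hφ : ∀ x y, φ x y = φ y x) (f : Equiv.Perm α) {a b : α} (hab : a ≠ b) :
    ∃ f' : Equiv.Perm α, ∑ y, φ y (f' y) + (φ a (f a) + φ b (f b)) =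
      ∑ y, φ y (f y) + (φ (f a) (f b) + φ a b) := by
  classical
  have hswap : ∀ (f : Equiv.Perm α) (x y : α), x ≠ y →
      ∑ z, φ z ((f * Equiv.swap x y) z) + (φ x (f x) + φ y (f y)) =
        ∑ z, φ z (f z) + (φ x (f y) + φ y (f x)) := by
    intro f x y hxy
    have hsplit : ∀ F : α → M, ∑ z, F z = F x + (F y + ∑ z ∈ (Finset.univ.erase x).erase y, F z) := by
      intro F
      rw [Finset.add_sum_erase _ F (Finset.mem_erase.2 ⟨hxy.symm, Finset.mem_univ y⟩),
        Finset.add_sum_erase _ F (Finset.mem_univ x)]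
    rw [hsplit, hsplit (fun z => φ z (f z))]
    have hrest : ∑ z ∈ (Finset.univ.erase x).erase y, φ z ((f * Equiv.swap x y) z) =
        ∑ z ∈ (Finset.univ.erase x).erase y, φ z (f z) := by
      refine Finset.sum_congr rfl fun z hz => ?_
      simp only [Finset.mem_erase, Finset.mem_univ, and_true] at hz
      rw [Equiv.Perm.mul_apply, Equiv.swap_apply_of_ne_of_ne hz.2 hz.1]
    rw [hrest]
    simp only [Equiv.Perm.mul_apply, Equiv.swap_apply_left, Equiv.swap_apply_right]
    abel
  have hcase : ∀ (f : Equiv.Perm α), ¬ f.SameCycle a b →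
      ∃ f' : Equiv.Perm α, ∑ y, φ y (f' y) + (φ a (f a) + φ b (f b)) =
        ∑ y, φ y (f y) + (φ (f a) (f b) + φ a b) := by
    intro f hf
    obtain ⟨r, hra, hr, hsum⟩ := f.exists_reverse_cycle φ hφ a
    have hne : f a ≠ b := by
      rintro rfl
      exact hf (Equiv.Perm.sameCycle_apply_right.2 (Equiv.Perm.SameCycle.refl f a))
    refine ⟨r * Equiv.swap (f a) b, ?_⟩
    have := hswap r (f a) b hne
    rwa [hra, hr b hf, hsum, hφ (f a) a, hφ b a] at this
  by_cases hf : f.SameCycle a b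
  · obtain ⟨f', hf'⟩ := hcase (f * Equiv.swap a b)
      fun h => hf.not_sameCycle_mul_swap hab h.symm
    simp only [Equiv.Perm.mul_apply, Equiv.swap_apply_left, Equiv.swap_apply_right] at hf'
    refine ⟨f', ?_⟩
    have := hswap f a b hab
    rw [hφ (f b) (f a)] at hf'
    simp only [Equiv.Perm.mul_apply] at this
    refine add_right_cancel (b := φ a (f b) + φ b (f a)) ?_
    rw [add_right_comm, hf', add_right_comm, this, add_right_comm]
  · exact hcase f hf

/-- In the multiset of quotients `y⁻¹ * f y` of a permutation of a finite abelian group, two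
entries may be replaced by any two elements with the same product. -/
theorem Equiv.Perm.exists_replace_quotients {K : Type*} [CommGroup K] [Fintype K]
    (f : Equiv.Perm K) {p q p' q' : K} {X : Multiset K}
    (hf : Finset.univ.val.map (fun y => y⁻¹ * f y) = p ::ₘ q ::ₘ X) (hpq : p' * q' = p * q) :
    ∃ f' : Equiv.Perm K, Finset.univ.val.map (fun y => y⁻¹ * f' y) = p' ::ₘ q' ::ₘ X := by
  classical
  have hp : p ∈ Finset.univ.val.map (fun y => y⁻¹ * f y) := by simp [hf]
  obtain ⟨a, ha, rfl⟩ := Multiset.mem_map.1 hp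
  obtain ⟨R, hR⟩ := Multiset.exists_cons_of_mem ha
  have hnodup : (a ::ₘ R).Nodup := hR ▸ Finset.univ.nodup
  rw [hR, Multiset.map_cons, Multiset.cons_inj_right] at hf
  have hq : q ∈ R.map (fun y => y⁻¹ * f y) := by simp [hf]
  obtain ⟨b, hb, rfl⟩ := Multiset.mem_map.1 hq
  have hab : a ≠ b := by
    rintro rfl
    exact (Multiset.nodup_cons.1 hnodup).1 hb
  let c : K := p'⁻¹ * f a * f b
  obtain ⟨r, hr⟩ := Equiv.Perm.exists_exchange
    (fun y z => ({c⁻¹ * y * z} : Multiset K)) (fun x y => by rw [mul_right_comm])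
    ((Equiv.divLeft c).trans f) (a := c / a) (b := c / b) (by simpa using hab)
  refine ⟨(Equiv.divLeft c).trans r, ?_⟩
  have hmap : ∀ s : Equiv.Perm K, Finset.univ.val.map (fun y => y⁻¹ * s y) =
      ∑ y, ({c⁻¹ * y * ((Equiv.divLeft c).trans s) y} : Multiset K) := by
    intro s
    rw [← Equiv.sum_comp (Equiv.divLeft c), ← Fintype.sum_singleton_apply]
    refine Finset.sum_congr rfl fun y _ => ?_
    simp [div_eq_mul_inv]
  have hmul : ∀ y, c⁻¹ * (c / y) = y⁻¹ := fun y => by simp [div_eq_mul_inv]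
  have hr' : ∑ y, ({c⁻¹ * y * ((Equiv.divLeft c).trans ((Equiv.divLeft c).trans r)) y} :
      Multiset K) = ∑ y, {c⁻¹ * y * r y} := by simp
  have hp' : c⁻¹ * f a * f b = p' := by
    rw [mul_assoc, inv_mul_eq_iff_eq_mul]
    simp only [c]
    rw [mul_comm _ p', mul_assoc p'⁻¹, mul_inv_cancel_left]
  have hq' : a⁻¹ * (c / b) = q' := by
    have h : q' = p'⁻¹ * (a⁻¹ * f a * (b⁻¹ * f b)) := by
      rw [← hpq, inv_mul_cancel_left]
    rw [h, div_eq_mul_inv]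
    simp only [c]
    generalize a⁻¹ = x, b⁻¹ = y, p'⁻¹ = z
    ac_rfl
  rw [hmap, hr']
  simp only [Equiv.trans_apply, Equiv.divLeft_apply, div_div_cancel, hmul, hp', hq'] at hr
  have hs := hmap f
  rw [hR, Multiset.map_cons, hf] at hs
  simp only [Equiv.trans_apply, Equiv.divLeft_apply] at hs
  rw [← hs] at hr
  refine add_right_cancel (hr.trans ?_)
  simp only [← Multiset.singleton_add]
  abel

/-- **Hall's theorem**: a multiset of `|K|` elements with product `1` in a finite abelian
group `K` is the multiset of quotients `y⁻¹ * f y` of a permutation `f`. -/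
theorem exists_perm_quotients_eq {K : Type*} [CommGroup K] [Fintype K] (A : Multiset K)
    (hcard : Multiset.card A = Fintype.card K) (hprod : A.prod = 1) :
    ∃ f : Equiv.Perm K, Finset.univ.val.map (fun y => y⁻¹ * f y) = A := by
  have key : ∀ T : Multiset K, ∀ k : ℕ, Multiset.card T + k + 1 = Fintype.card K →
      ∃ f : Equiv.Perm K, Finset.univ.val.map (fun y => y⁻¹ * f y) =
        T.prod⁻¹ ::ₘ (T + Multiset.replicate k 1) := by
    intro T
    induction T using Multiset.induction_on with
    | empty =>
      intro k hk
      refine ⟨1, ?_⟩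
      simp only [Multiset.card_zero, zero_add] at hk
      simp [← hk, ← Multiset.replicate_succ]
    | cons a T ih =>
      intro k hk
      rw [Multiset.card_cons] at hk
      obtain ⟨f, hf⟩ := ih (k + 1) (by omega)
      rw [Multiset.replicate_succ, Multiset.add_cons] at hf
      obtain ⟨f', hf'⟩ := f.exists_replace_quotients hf
        (p' := (a ::ₘ T).prod⁻¹) (q' := a) (by simp)
      exact ⟨f', by rw [hf', Multiset.cons_add]⟩
  obtain ⟨x, hx⟩ : ∃ x, x ∈ A := by
    rw [← Multiset.card_pos_iff_exists_mem, hcard]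
    exact Fintype.card_pos
  obtain ⟨T, rfl⟩ := Multiset.exists_cons_of_mem hx
  obtain ⟨f, hf⟩ := key T 0 (by simpa using hcard)
  refine ⟨f, ?_⟩
  rw [hf, Multiset.replicate_zero, add_zero]
  rw [Multiset.prod_cons] at hprod
  rw [← eq_inv_of_mul_eq_one_left hprod]

/-- The inverses of the left coset representatives of `H` represent its right cosets. -/
theorem Subgroup.bijective_inv_mul_inv_out {G : Type*} [Group G] (H : Subgroup G) :
    Function.Bijective fun x : (G ⧸ H) × H => (x.2 : G)⁻¹ * x.1.out⁻¹ := by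
  constructor
  · rintro ⟨q, h⟩ ⟨q', h'⟩ heq
    have heq' : q.out * (h : G) = q'.out * (h' : G) := by
      simpa [← mul_inv_rev] using heq
    have hq : q = q' := by
      have := congrArg (QuotientGroup.mk (s := H)) heq'
      simpa [QuotientGroup.mk_mul_of_mem] using this
    subst hq
    simpa using heq'
  · intro x
    obtain ⟨h, hh⟩ := QuotientGroup.mk_out_eq_mul H x⁻¹
    exact ⟨((x⁻¹ : G), h⁻¹), by simp [hh]⟩

theorem quotientRealizable_iff_exists_perm {G : Type*} [Group G] [Fintype G] (A : Multiset G) :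
    QuotientRealizable G A ↔
      ∃ f : Equiv.Perm G, A = Finset.univ.val.map fun x => x * (f x)⁻¹ := by
  have hmap : ∀ b c : Fin (Nat.card G) ≃ G, (↑(List.ofFn fun i => b i * (c i)⁻¹) : Multiset G) =
      Finset.univ.val.map fun x => x * ((b.symm.trans c) x)⁻¹ := by
    intro b c
    rw [← Multiset.map_univ_val_equiv b, Multiset.map_map, ← Fin.univ_val_map]
    simp
  constructor
  · rintro ⟨b, c, rfl⟩
    exact ⟨b.symm.trans c, hmap b c⟩
  · rintro ⟨f, rfl⟩
    refine ⟨(Finite.equivFin G).symm, (Finite.equivFin G).symm.trans f, ?_⟩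
    rw [hmap]
    simp

/-- For a multiset supported in the cyclic subgroup `H = ⟨g⟩` of order `d`,
quotient-realizability in `G` is equivalent to a partition into `[G:H]` blocks of
cardinality `d`, written as powers of `g`, whose exponent sums vanish mod `d`. -/
theorem stmt7 {G : Type*} [Group G] [Finite G] (g : G) (d : ℕ)
    (hd : orderOf g = d) (A : Multiset G)
    (hA : Multiset.card A = Nat.card G)
    (hsupp : ∀ a ∈ A, a ∈ Subgroup.zpowers g) :
    QuotientRealizable G A ↔
      ∃ B : Fin (Subgroup.zpowers g).index → Multiset G,
        A = ∑ j, B j ∧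
        ∀ j, ∃ e : Fin d → ℕ,
          B j = ↑(List.ofFn fun i => g ^ (e i)) ∧
          (∑ i, e i) % d = 0 := by
  classical
  have := Fintype.ofFinite G
  let H := Subgroup.zpowers g
  have hgd : g ^ d = 1 := hd ▸ pow_orderOf_eq_one g
  have hcardH : Nat.card H = d := by rw [← hd]; exact Nat.card_zpowers g
  let cH : CommGroup H := { (inferInstance : Group H) with mul_comm := mul_comm' }
  let φ : (G ⧸ H) × H ≃ G := Equiv.ofBijective _ H.bijective_inv_mul_inv_out
  have hφ : ∀ q h, φ (q, h) = (h : G)⁻¹ * q.out⁻¹ := fun _ _ => rfl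
  let ι : Fin H.index ≃ G ⧸ H := (Finite.equivFin (G ⧸ H)).symm
  let ε : Fin d ≃ H := (finCongr hcardH.symm).trans (Finite.equivFin H).symm
  have hmap : ∀ F : G → G, Finset.univ.val.map F =
      ∑ j, Finset.univ.val.map fun h => F (φ (ι j, h)) := by
    intro F
    rw [← Fintype.sum_singleton_apply, ← Equiv.sum_comp φ, Fintype.sum_prod_type,
      ← Equiv.sum_comp ι]
    simp only [Fintype.sum_singleton_apply]
  rw [quotientRealizable_iff_exists_perm]
  constructor
  · rintro ⟨f, rfl⟩
    refine ⟨_, hmap _, fun j => ?_⟩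
    have hk : ∀ h, φ (ι j, h) * (f (φ (ι j, h)))⁻¹ ∈ H := fun h =>
      hsupp _ (Multiset.mem_map_of_mem _ (Finset.mem_univ_val _))
    let k : H → H := fun h => ⟨_, hk h⟩
    have hf : ∀ h, f (φ (ι j, h)) = φ (ι j, h * k h) := by
      intro h
      have : (k h : G) = φ (ι j, h) * (f (φ (ι j, h)))⁻¹ := rfl
      rw [hφ _ (h * k h), Subgroup.coe_mul, mul_inv_rev, mul_assoc, ← hφ, this]
      group
    have hinj : Function.Injective fun h => h * k h := by
      intro h h' heq
      have : f (φ (ι j, h)) = f (φ (ι j, h')) := by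
        rw [hf, hf]
        exact congrArg (fun x => φ (ι j, x)) heq
      simpa using this
    have hprod : ∏ h, k h = 1 := by
      have h1 : ∏ h, h * k h = ∏ h : H, h :=
        (Finite.injective_iff_bijective.1 hinj).prod_comp fun h => h
      rwa [Finset.prod_mul_distrib, mul_eq_left] at h1
    have he : ∀ i, ∃ n : ℕ, g ^ n = k (ε i) := fun i =>
      mem_powers_iff_mem_zpowers.2 (k (ε i)).2
    choose e he using he
    refine ⟨e, ?_, ?_⟩
    · rw [← Multiset.map_univ_val_equiv ε, Multiset.map_map, ← Fin.univ_val_map]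
      exact Multiset.map_congr rfl fun i _ => (he i).symm
    · apply Nat.mod_eq_zero_of_dvd
      refine hd.symm.dvd.trans (orderOf_dvd_of_pow_eq_one ?_)
      have : ∏ i, k (ε i) = 1 := by rw [Equiv.prod_comp, hprod]
      have h2 : ∏ i, (⟨g, Subgroup.mem_zpowers g⟩ : H) ^ e i = 1 := by
        rw [← this]
        exact Finset.prod_congr rfl fun i _ => Subtype.ext (he i)
      rw [Finset.prod_pow_eq_pow_sum] at h2
      exact congrArg Subtype.val h2
  · rintro ⟨B, rfl, hB⟩
    choose e hBe he using hB
    have hall : ∀ j, ∃ s : Equiv.Perm H, Finset.univ.val.map (fun y => y⁻¹ * s y) =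
        Finset.univ.val.map fun i => (⟨g, Subgroup.mem_zpowers g⟩ : H) ^ e j i := by
      intro j
      apply exists_perm_quotients_eq
      · rw [Multiset.card_map, Finset.card_val, Finset.card_univ, Fintype.card_fin,
          ← Nat.card_eq_fintype_card, hcardH]
      · change ∏ i, (⟨g, Subgroup.mem_zpowers g⟩ : H) ^ e j i = 1
        rw [Finset.prod_pow_eq_pow_sum]
        apply Subtype.ext
        obtain ⟨m, hm⟩ := Nat.dvd_of_mod_eq_zero (he j)
        change g ^ (∑ i, e j i) = 1
        rw [hm, pow_mul, hgd, one_pow]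
    choose s hs using hall
    let f : Equiv.Perm G := φ.permCongr (Equiv.prodShear (Equiv.refl _) fun q => s (ι.symm q))
    have hf : ∀ j h, f (φ (ι j, h)) = φ (ι j, s j h) := by
      intro j h
      simp [f, Equiv.permCongr_apply]
    refine ⟨f, ?_⟩
    rw [hmap]
    refine Finset.sum_congr rfl fun j _ => ?_
    have := congrArg (Multiset.map (Subtype.val : H → G)) (hs j)
    rw [Multiset.map_map, Multiset.map_map] at this
    rw [hBe, ← Fin.univ_val_map]
    refine Eq.trans this.symm ?_
    refine Multiset.map_congr rfl fun h _ => ?_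
    rw [hf, hφ, hφ]
    simp
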